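/- Let k ≥ 1, let a = a1 ++ ⋯ ++ am be a concatenation of sequences of terms, let j ∈ {1,…,m}, and suppose aj ≻_k aj′. Then a ≻_k a1 ++ ⋯ ++ a_{j−1} ++ aj′ ++ a_{j+1} ++ ⋯ ++ am. -/

import Mathlib

set_option maxHeartbeats 1000000

/-- First-order terms over a signature `F`, with variables drawn from `ℕ`. -/
inductive Tm (F : Type) : Type
  | var : ℕ → Tm F
  | fn  : F → List (Tm F) → Tm F

instance {F : Type} : Inhabited (Tm F) := ⟨Tm.var 0⟩

/-- The size `|t|` of a term. -/
def Tm.size {F} : Tm F → ℕ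
  | .var _ => 1
  | .fn _ ts => 1 + (ts.attach.map fun t => t.1.size).sum
decreasing_by have := List.sizeOf_lt_of_mem t.2; simp_wf; omega

/-- The depth of a term (variables and constants have depth 0). -/
def Tm.depth {F} : Tm F → ℕ
  | .var _ => 0
  | .fn _ [] => 0
  | .fn f (t :: ts) => max (t.depth + 1) (Tm.fn f ts).depth

/-- A (quasi-)precedence: a preorder `le` (i.e. `f ≿ g`) on the signature whose
strict part `≻` is well-founded. -/
structure Precedence (F : Type) where
  le : F → F → Prop
  refl : ∀ f, le f f
  trans : ∀ {f g h}, le f g → le g h → le f h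
  wf : WellFounded (fun g f => le f g ∧ ¬ le g f)

/-- The strict part `f ≻ g` of a precedence. -/
def Precedence.strict {F} (P : Precedence F) (f g : F) : Prop := P.le f g ∧ ¬ P.le g f

/-- The equivalence part `f ∼ g` of a precedence. -/
def Precedence.equiv {F} (P : Precedence F) (f g : F) : Prop := P.le f g ∧ P.le g f

/-- Term equivalence `s ≈ t` induced by the equivalence part of a precedence. -/
inductive TmEq {F} (P : Precedence F) : Tm F → Tm F → Prop
  | refl (t) : TmEq P t t
  | fn {f g : F} {ss ts : List (Tm F)} :
      P.equiv f g → ss.length = ts.length →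
      (∀ i, i < ss.length → TmEq P (ss.getD i default) (ts.getD i default)) →
      TmEq P (.fn f ss) (.fn g ts)

/-- `s` is a strict superterm of `t` modulo term equivalence `≈`. -/
inductive StrictSup {F} (P : Precedence F) : Tm F → Tm F → Prop
  | here {f : F} {ss : List (Tm F)} {s t : Tm F} :
      s ∈ ss → TmEq P s t → StrictSup P (.fn f ss) t
  | there {f : F} {ss : List (Tm F)} {s t : Tm F} :
      s ∈ ss → StrictSup P s t → StrictSup P (.fn f ss) t

mutual
/-- The order `a ≻_k b` (EPO) on finite sequences of terms, w.r.t. precedence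
`P` and defined-symbol predicate `D`; terms are identified with singleton
sequences, `++` is concatenation. -/
inductive Epo {F} (P : Precedence F) (D : F → Bool) (k : ℕ) :
    List (Tm F) → List (Tm F) → Prop
  /- (1) `a = f(s₁,…,s_m)` and `sᵢ (≻_k ∪ ≈) b` for some `i` -/
  | arg {f : F} {ss : List (Tm F)} {s : Tm F} {b : List (Tm F)} :
      s ∈ ss → EpoEq P D k [s] b → Epo P D k [Tm.fn f ss] b
  /- (2) `a = f(s₁,…,s_m)`, `f` defined, `b = [t₁ … t_n]` with `n = 0` or
     `2 ≤ n ≤ k`, and `a ≻_k t_j` for all `j` -/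
  | seq {f : F} {ss ts : List (Tm F)} :
      D f = true →
      (ts.length = 0 ∨ (2 ≤ ts.length ∧ ts.length ≤ k)) →
      (∀ t ∈ ts, Epo P D k [Tm.fn f ss] [t]) →
      Epo P D k [Tm.fn f ss] ts
  /- (3) `a = f(…)`, `f` defined, `b = g(t₁,…,t_n)` with `n ≤ k`, `f ≻ g`, and
     `a` is a strict superterm modulo `≈` of every `t_j` -/
  | prec {f g : F} {ss ts : List (Tm F)} :
      D f = true → P.strict f g → ts.length ≤ k →
      (∀ t ∈ ts, StrictSup P (Tm.fn f ss) t) →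
      Epo P D k [Tm.fn f ss] [Tm.fn g ts]
  /- (4) `a = [s₁ … s_m]`, `b = b₁ ++ ⋯ ++ b_m`, and for some `j`:
     `sᵢ ≈ bᵢ` for `i < j`, `s_j ≻_k b_j`, and `sᵢ (≻_k ∪ ≈) bᵢ` for `i > j` -/
  | lst {ss : List (Tm F)} {bs : List (List (Tm F))} {j : ℕ} :
      bs.length = ss.length → j < ss.length →
      (∀ i, i < j → ∃ t, bs.getD i [] = [t] ∧ TmEq P (ss.getD i default) t) →
      Epo P D k [ss.getD j default] (bs.getD j []) →
      (∀ i, j < i → i < ss.length → EpoEq P D k [ss.getD i default] (bs.getD i [])) →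
      Epo P D k ss bs.flatten
  /- (5) `a = f(s₁,…,s_m)`, `b = g(t₁,…,t_n)` with `n ≤ k`, `f ∼ g` both
     defined, and for some `j ≤ min(m,n)`: `sᵢ ≈ tᵢ` for `i < j`, `s_j` is a
     strict superterm mod `≈` of `t_j`, and `a` is a strict superterm mod `≈`
     of `tᵢ` for `i > j` -/
  | equiv {f g : F} {ss ts : List (Tm F)} {j : ℕ} :
      D f = true → D g = true → P.equiv f g → ts.length ≤ k →
      j < ss.length → j < ts.length →
      (∀ i, i < j → TmEq P (ss.getD i default) (ts.getD i default)) →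
      StrictSup P (ss.getD j default) (ts.getD j default) →
      (∀ i, j < i → i < ts.length → StrictSup P (Tm.fn f ss) (ts.getD i default)) →
      Epo P D k [Tm.fn f ss] [Tm.fn g ts]

/-- `≻_k ∪ ≈` (terms identified with singleton sequences). -/
inductive EpoEq {F} (P : Precedence F) (D : F → Bool) (k : ℕ) :
    List (Tm F) → List (Tm F) → Prop
  | epo {a b} : Epo P D k a b → EpoEq P D k a b
  | eq {s t : Tm F} : TmEq P s t → EpoEq P D k [s] [t]
end

/-- Every comparison `a ≻_k b` arises from a componentwise one: `b` splits into one
block for each term of `a`, compared as in clause (4). -/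
theorem Epo.exists_blocks {F : Type} {P : Precedence F} {D : F → Bool} {k : ℕ}
    {a b : List (Tm F)} (h : Epo P D k a b) :
    ∃ (bs : List (List (Tm F))) (j : ℕ), b = bs.flatten ∧ bs.length = a.length ∧
      j < a.length ∧
      (∀ i, i < j → ∃ t, bs.getD i [] = [t] ∧ TmEq P (a.getD i default) t) ∧
      Epo P D k [a.getD j default] (bs.getD j []) ∧
      (∀ i, j < i → i < a.length → EpoEq P D k [a.getD i default] (bs.getD i [])) := by
  have singleton {s : Tm F} (hs : Epo P D k [s] b) :
      ∃ (bs : List (List (Tm F))) (j : ℕ), b = bs.flatten ∧ bs.length = [s].length ∧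
        j < [s].length ∧
        (∀ i, i < j → ∃ t, bs.getD i [] = [t] ∧ TmEq P ([s].getD i default) t) ∧
        Epo P D k [[s].getD j default] (bs.getD j []) ∧
        (∀ i, j < i → i < [s].length →
          EpoEq P D k [[s].getD i default] (bs.getD i [])) := by
    refine ⟨[b], 0, by simp, rfl, by simp, by simp, by simpa using hs, ?_⟩
    intro i hi hi'
    simp at hi'
    omega
  cases h with
  | lst hlen hj hlt heq hgt => exact ⟨_, _, rfl, hlen, hj, hlt, heq, hgt⟩
  | arg hs he => exact singleton (.arg hs he)
  | seq hf hn ht => exact singleton (.seq hf hn ht)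
  | prec hf hfg hn ht => exact singleton (.prec hf hfg hn ht)
  | equiv hf hg hfg hn hj hj' hlt heq hgt =>
    exact singleton (.equiv hf hg hfg hn hj hj' hlt heq hgt)

/-- The order `≻_k` is closed under adding terms on both sides of a sequence. -/
theorem Epo.append_context {F : Type} {P : Precedence F} {D : F → Bool} {k : ℕ}
    {a b : List (Tm F)} (h : Epo P D k a b) (p q : List (Tm F)) :
    Epo P D k (p ++ (a ++ q)) (p ++ (b ++ q)) := by
  obtain ⟨bs, j, rfl, hlen, hj, hlt, heq, hgt⟩ := h.exists_blocks
  have flatten_blocks (l : List (Tm F)) : (l.map fun t => [t]).flatten = l := by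
    induction l with
    | nil => rfl
    | cons t l ih => simp [ih]
  have getD_blocks (l : List (Tm F)) (i : ℕ) (hi : i < l.length) :
      (l.map fun t => [t]).getD i [] = [l.getD i default] := by
    simp [List.getD_eq_getElem?_getD, hi]
  have key : p ++ (bs.flatten ++ q) =
      (p.map (fun t => [t]) ++ (bs ++ q.map fun t => [t])).flatten := by
    simp only [List.flatten_append, flatten_blocks]
  have term_mid (i : ℕ) (hi : p.length ≤ i) (hi' : i - p.length < a.length) :
      (p ++ (a ++ q)).getD i default = a.getD (i - p.length) default := by
    rw [List.getD_append_right _ _ _ _ hi, List.getD_append _ _ _ _ hi']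
  have block_mid (i : ℕ) (hi : p.length ≤ i) (hi' : i - p.length < a.length) :
      (p.map (fun t => [t]) ++ (bs ++ q.map fun t => [t])).getD i [] =
        bs.getD (i - p.length) [] := by
    rw [List.getD_append_right _ _ _ _ (by simpa using hi), List.length_map,
      List.getD_append _ _ _ _ (by omega)]
  rw [key]
  refine Epo.lst (j := p.length + j) (by simp [hlen]) (by simp; omega) ?_ ?_ ?_
  · intro i hi
    by_cases hip : i < p.length
    · rw [List.getD_append _ _ _ _ (by simpa using hip), List.getD_append _ _ _ _ hip]
      exact ⟨_, getD_blocks p i hip, .refl _⟩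
    · rw [block_mid i (by omega) (by omega), term_mid i (by omega) (by omega)]
      exact hlt _ (by omega)
  · rw [block_mid _ (by omega) (by omega), term_mid _ (by omega) (by omega)]
    simpa using heq
  · intro i hi hi'
    simp only [List.length_append] at hi'
    by_cases hia : i - p.length < a.length
    · rw [block_mid i (by omega) hia, term_mid i (by omega) hia]
      exact hgt _ (by omega) hia
    · have hpi : p.length ≤ i := by omega
      rw [List.getD_append_right p _ _ _ hpi, List.getD_append_right a _ _ _ (by omega),
        List.getD_append_right (p.map _) _ _ _ (by simpa using hpi), List.length_map,
        List.getD_append_right bs _ _ _ (by omega), hlen, getD_blocks q _ (by omega)]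
      exact .eq (.refl _)

/-- Lemma 3.3: if `a = a₁ ++ ⋯ ++ a_m`, `j ∈ {1,…,m}` and `a_j ≻_k a_j'`, then
`a ≻_k a₁ ++ ⋯ ++ a_{j-1} ++ a_j' ++ a_{j+1} ++ ⋯ ++ a_m`. -/
theorem epo_replace_component {F : Type} (P : Precedence F) (D : F → Bool)
    (k : ℕ) (hk : 1 ≤ k) (as : List (List (Tm F))) (j : ℕ) (hj : j < as.length)
    (a' : List (Tm F)) (h : Epo P D k (as.getD j []) a') :
    Epo P D k as.flatten (as.set j a').flatten := by
  have hsplit : as.flatten =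
      (as.take j).flatten ++ (as.getD j [] ++ (as.drop (j + 1)).flatten) := by
    rw [List.getD_eq_getElem _ _ hj, ← List.flatten_cons, List.getElem_cons_drop,
      ← List.flatten_append, List.take_append_drop]
  rw [hsplit, List.set_eq_take_append_cons_drop, if_pos hj, List.flatten_append,
    List.flatten_cons]
  exact h.append_context _ _
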